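/- There is no rational polygon P whose Ehrhart quasi-polynomial is a polynomial (quasi-period 1) and which has no lattice points on its boundary. -/

import Mathlib

open Pointwise

/-- The number of lattice points in the `n`-th dilate of `S ⊆ ℝ²`. -/
noncomputable def ehr (S : Set (ℝ × ℝ)) (n : ℕ) : ℕ :=
  {z : ℤ × ℤ | ((z.1 : ℝ), (z.2 : ℝ)) ∈ (n : ℝ) • S}.ncard


noncomputable def gs (f : ℤ → ℤ) (m : ℤ) : ℤ := ∑ x ∈ Finset.Ico 0 m, f x - ∑ x ∈ Finset.Ico m 0, f x

lemma gs_succ (f : ℤ → ℤ) (m : ℤ) : gs f (m+1) = gs f m + f m := by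
  unfold gs
  rcases le_or_gt 0 m with h | h
  · have h1 : Finset.Ico 0 (m+1) = insert m (Finset.Ico 0 m) := by
      ext x; simp only [Finset.mem_Ico, Finset.mem_insert]; omega
    rw [h1, Finset.sum_insert (by simp), Finset.Ico_eq_empty (a := m) (by omega),
      Finset.Ico_eq_empty (a := m+1) (by omega)]
    simp; ring
  · have h1 : Finset.Ico m 0 = insert m (Finset.Ico (m+1) 0) := by
      ext x; simp only [Finset.mem_Ico, Finset.mem_insert]; omega
    rw [h1, Finset.sum_insert (by simp), Finset.Ico_eq_empty (b := m) (by omega),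
      Finset.Ico_eq_empty (b := m+1) (by omega)]
    simp

lemma gs_sub (f : ℤ → ℤ) (a b : ℤ) (h : a ≤ b) :
    ∑ x ∈ Finset.Ico a b, f x = gs f b - gs f a := by
  induction b, h using Int.leInduction with
  | base => simp
  | succ b hab ih =>
    have h1 : Finset.Ico a (b+1) = insert b (Finset.Ico a b) := by
      ext x; simp only [Finset.mem_Ico, Finset.mem_insert]; omega
    rw [h1, Finset.sum_insert (by simp), ih, gs_succ]; ring

lemma int_ind {P : ℤ → Prop} (h0 : P 0) (h : ∀ t, P t ↔ P (t+1)) (t : ℤ) : P t := by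
  induction t using Int.induction_on with
  | zero => exact h0
  | succ i ih => exact (h _).1 ih
  | pred i ih => exact (h _).2 (by simpa using ih)

lemma gs_add (f g : ℤ → ℤ) (c : ℤ) (h : ∀ x, g x = f x + c) (m : ℤ) :
    gs g m = gs f m + c * m := by
  refine int_ind (P := fun m => gs g m = gs f m + c * m) (by simp [gs]) (fun t => ?_) m
  rw [gs_succ, gs_succ, h]
  constructor <;> intro h <;> linarith

lemma gs_quasi (f : ℤ → ℤ) (T c : ℤ) (h : ∀ x, f (x+T) = f x + c) (a : ℤ) :
    ∃ s e : ℚ, ∀ t : ℤ, (gs f (a + T*t) : ℚ) = gs f a + s * t + e * t^2 := by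
  have hd : ∀ m, gs f (m+T) - gs f m = gs f T - gs f 0 + c * m := by
    intro m
    refine int_ind (P := fun m => gs f (m+T) - gs f m = gs f T - gs f 0 + c * m) (by simp)
      (fun t => ?_) m
    rw [show t + 1 + T = (t+T) + 1 by ring, gs_succ, gs_succ, h]
    constructor <;> intro h <;> linarith
  refine ⟨(gs f T - gs f 0 + c * a : ℤ) - c * T / 2, c * T / 2, fun t => ?_⟩
  refine int_ind (P := fun t : ℤ => (gs f (a + T*t) : ℚ) = gs f a +
    ((gs f T - gs f 0 + c * a : ℤ) - c * T / 2) * t + (c * T / 2) * t^2) (by simp)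
      (fun t => ?_) t
  have h2 := hd (a + T*t)
  rw [show a + T*t+T = a + T*(t+1) by ring] at h2
  have h3 : (gs f (a + T*(t+1)) : ℚ) = gs f (a+T*t) + (gs f T - gs f 0 + c * (a+T*t) : ℤ) := by
    rw [← h2]; push_cast; ring
  rw [h3]; push_cast
  constructor <;> intro h <;> linarith

def QP (D : ℤ) (f : ℤ → ℚ) : Prop :=
  ∀ r : ℤ, ∃ a b c : ℚ, ∀ k : ℤ, f (r + D * k) = a + b * k + c * k^2

lemma QP.add {D f g} (hf : QP D f) (hg : QP D g) : QP D (fun n => f n + g n) := by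
  intro r
  obtain ⟨a, b, c, h⟩ := hf r
  obtain ⟨a', b', c', h'⟩ := hg r
  exact ⟨a+a', b+b', c+c', fun k => by simp only [h, h']; ring⟩

lemma QP.sub {D f g} (hf : QP D f) (hg : QP D g) : QP D (fun n => f n - g n) := by
  intro r
  obtain ⟨a, b, c, h⟩ := hf r
  obtain ⟨a', b', c', h'⟩ := hg r
  exact ⟨a-a', b-b', c-c', fun k => by simp only [h, h']; ring⟩

lemma QP.sum {D} (N : ℕ) (f : ℕ → ℤ → ℚ) (hf : ∀ i < N, QP D (f i)) :
    QP D (fun n => ∑ i ∈ Finset.range N, f i n) := by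
  induction N with
  | zero => intro r; exact ⟨0,0,0, by simp⟩
  | succ N ih =>
    simp only [Finset.sum_range_succ]
    exact (ih fun i hi => hf i (by omega)).add (hf N (by omega))

lemma QP_strip (φ : ℤ → ℤ → ℤ) (T M c c' j : ℤ) (hM : 0 < M)
    (h1 : ∀ n k x, φ (n + T*M*k) x = φ n x + c * k) (h2 : ∀ n x, φ n (x+T) = φ n x + c') :
    QP (T*M) (fun n => (gs (φ n) ⌈(n:ℚ) * (j / M)⌉ : ℚ)) := by
  intro r
  obtain ⟨s, e, h⟩ := gs_quasi (φ r) T c' (h2 r) ⌈(r:ℚ) * (j / M)⌉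
  refine ⟨gs (φ r) ⌈(r:ℚ) * (j / M)⌉, s * j + c * ⌈(r:ℚ) * (j / M)⌉, e * j^2 + c * T * j,
    fun k => ?_⟩
  have hM' : (M:ℚ) ≠ 0 := by positivity
  have h3 : ⌈((r + T*M*k : ℤ):ℚ) * (j / M)⌉ = ⌈(r:ℚ) * (j / M)⌉ + T*(j*k) := by
    rw [← Int.ceil_add_intCast]; congr 1; push_cast; field_simp
  simp only
  rw [h3, gs_add (φ r) (φ (r+T*M*k)) (c*k) (h1 r k)]
  push_cast
  rw [h]; push_cast; ring

/-- linear piece -/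
def lpc (M J : ℤ) (u u' : ℚ) (n x : ℤ) : ℚ := n * u + (u' - u) * (M * x - n * J)

def ph (M J : ℤ) (u u' g g' : ℚ) (n x : ℤ) : ℤ := ⌊lpc M J u u' n x⌋ - ⌈lpc M J g g' n x⌉ + 1

lemma QP_ph (M J T : ℤ) (u u' g g' : ℚ) (j : ℤ) (hM : 0 < M) (hu : ∃ a : ℤ, T * u = a)
    (hu' : ∃ a : ℤ, T * u' = a) (hg : ∃ a : ℤ, T * g = a) (hg' : ∃ a : ℤ, T * g' = a) :
    QP (T*M) (fun n => (gs (ph M J u u' g g' n) ⌈(n:ℚ) * (j / M)⌉ : ℚ)) := by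
  obtain ⟨a, ha⟩ := hu
  obtain ⟨a', ha'⟩ := hu'
  obtain ⟨b, hb⟩ := hg
  obtain ⟨b', hb'⟩ := hg'
  have e1 : ∀ (u u' : ℚ) (a a' : ℤ), T * u = a → T * u' = a' → ∀ n k x : ℤ,
      lpc M J u u' (n + T*M*k) x = lpc M J u u' n x + ((M * (a - (a' - a) * J)) * k : ℤ) := by
    intro u u' a a' h h' n k x
    unfold lpc; push_cast; rw [← h, ← h']; ring
  have e2 : ∀ (u u' : ℚ) (a a' : ℤ), T * u = a → T * u' = a' → ∀ n x : ℤ,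
      lpc M J u u' n (x+T) = lpc M J u u' n x + ((M * (a' - a)) : ℤ) := by
    intro u u' a a' h h' n x
    unfold lpc; push_cast; rw [← h, ← h']; ring
  refine QP_strip _ T M (M * (a - (a' - a) * J) - M * (b - (b' - b) * J))
    (M * (a' - a) - M * (b' - b)) j hM ?_ ?_
  · intro n k x
    unfold ph
    rw [e1 u u' a a' ha ha', e1 g g' b b' hb hb', Int.floor_add_intCast, Int.ceil_add_intCast]
    ring
  · intro n x
    unfold ph
    rw [e2 u u' a a' ha ha', e2 g g' b b' hb hb', Int.floor_add_intCast, Int.ceil_add_intCast]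
    ring

def en (y u g : ℚ) (n : ℤ) : ℤ := (⌊n * y⌋ - ⌈n * y⌉ + 1) * (⌊n * u⌋ - ⌈n * g⌉ + 1)

lemma QP_en (M T j : ℤ) (u g : ℚ) (hM : 0 < M) (hu : ∃ a : ℤ, T * u = a)
    (hg : ∃ a : ℤ, T * g = a) : QP (T*M) (fun n => (en (j/M) u g n : ℚ)) := by
  obtain ⟨a, ha⟩ := hu
  obtain ⟨b, hb⟩ := hg
  intro r
  have hM' : (M:ℚ) ≠ 0 := by positivity
  refine ⟨en (j/M) u g r, (⌊(r:ℚ) * (j/M)⌋ - ⌈(r:ℚ) * (j/M)⌉ + 1) * (M * (a-b)), 0, fun k => ?_⟩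
  have h1 : ((r + T*M*k : ℤ):ℚ) * (j / M) = (r:ℚ) * (j / M) + (T*(j*k) : ℤ) := by
    push_cast; field_simp
  have h2 : ((r + T*M*k : ℤ):ℚ) * u = r * u + (M*a*k : ℤ) := by
    push_cast; rw [← ha]; ring
  have h3 : ((r + T*M*k : ℤ):ℚ) * g = r * g + (M*b*k : ℤ) := by
    push_cast; rw [← hb]; ring
  simp only [en]
  rw [h1, h2, h3]
  simp only [Int.floor_add_intCast, Int.ceil_add_intCast]
  push_cast; ring

def xp (M X : ℤ) (i : ℕ) : ℚ := ((X + i : ℤ) : ℚ) / M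

noncomputable def EE (M X : ℤ) (N : ℕ) (U G : ℚ → ℚ) (n : ℤ) : ℤ :=
  ∑ i ∈ Finset.range N,
    (gs (ph M (X+i) (U (xp M X i)) (U (xp M X (i+1))) (G (xp M X i)) (G (xp M X (i+1))) n)
        ⌈n * xp M X (i+1)⌉
      - gs (ph M (X+i) (U (xp M X i)) (U (xp M X (i+1))) (G (xp M X i)) (G (xp M X (i+1))) n)
        ⌈n * xp M X i⌉)
  + en (xp M X N) (U (xp M X N)) (G (xp M X N)) n

def PLin (M X : ℤ) (N : ℕ) (U : ℚ → ℚ) : Prop :=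
  ∀ i < N, ∀ x : ℚ, xp M X i ≤ x → x ≤ xp M X (i+1) →
    U x = U (xp M X i) + (U (xp M X (i+1)) - U (xp M X i)) * (M * x - (X + i : ℤ))

lemma QP_EE (M X : ℤ) (N : ℕ) (U G : ℚ → ℚ) (T : ℤ) (hM : 0 < M)
    (hU : ∀ i ≤ N, ∃ a : ℤ, T * U (xp M X i) = a)
    (hG : ∀ i ≤ N, ∃ a : ℤ, T * G (xp M X i) = a) :
    QP (T*M) (fun n => (EE M X N U G n : ℚ)) := by
  unfold EE
  push_cast
  refine QP.add (QP.sum N _ fun i hi => QP.sub ?_ ?_) ?_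
  · exact QP_ph M (X+i) T _ _ _ _ (X + (i+1:ℕ)) hM (hU i (by omega)) (hU (i+1) (by omega))
      (hG i (by omega)) (hG (i+1) (by omega))
  · exact QP_ph M (X+i) T _ _ _ _ (X + i) hM (hU i (by omega)) (hU (i+1) (by omega))
      (hG i (by omega)) (hG (i+1) (by omega))
  · exact QP_en M T (X+N) _ _ hM (hU N le_rfl) (hG N le_rfl)

lemma lpc_eq {M X : ℤ} {N : ℕ} {U : ℚ → ℚ} (hU : PLin M X N U) (i : ℕ) (hi : i < N)
    (n x : ℤ) (hn : 0 < n) (h1 : n * xp M X i ≤ x) (h2 : x ≤ n * xp M X (i+1)) :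
    lpc M (X+i) (U (xp M X i)) (U (xp M X (i+1))) n x = n * U (x / n) := by
  have hn' : (0:ℚ) < n := by exact_mod_cast hn
  rw [hU i hi (x/n) (by rw [le_div_iff₀ hn']; linarith) (by rw [div_le_iff₀ hn']; linarith)]
  unfold lpc
  field_simp

lemma lpc_neg (M J : ℤ) (u u' : ℚ) (n x : ℤ) : lpc M J u u' (-n) (-x) = - lpc M J u u' n x := by
  unfold lpc; push_cast; ring

lemma xp_mono {M X : ℤ} (hM : 0 < M) (i : ℕ) : xp M X i ≤ xp M X (i+1) := by
  unfold xp
  have : (0:ℚ) < M := by exact_mod_cast hM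
  gcongr; omega

lemma xp_mono' {M X : ℤ} (hM : 0 < M) (i : ℕ) : xp M X 0 ≤ xp M X i := by
  unfold xp
  have : (0:ℚ) < M := by exact_mod_cast hM
  gcongr; omega

lemma sum_Ico_Icc (f : ℤ → ℤ) (a : ℤ) (y : ℚ) (h : a ≤ ⌈y⌉) :
    ∑ x ∈ Finset.Ico a ⌈y⌉, f x + (⌊y⌋ - ⌈y⌉ + 1) * f ⌊y⌋ = ∑ x ∈ Finset.Icc a ⌊y⌋, f x := by
  have h1 := Int.floor_le_ceil y
  have h2 := Int.ceil_le_floor_add_one y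
  rcases eq_or_lt_of_le h1 with h3 | h3
  · rw [← h3] at h ⊢
    rw [show Finset.Icc a ⌊y⌋ = insert ⌊y⌋ (Finset.Ico a ⌊y⌋) by
      ext x; simp only [Finset.mem_Ico, Finset.mem_Icc, Finset.mem_insert]; omega,
      Finset.sum_insert (by simp)]
    ring
  · rw [show Finset.Icc a ⌊y⌋ = Finset.Ico a ⌈y⌉ by
      ext x; simp only [Finset.mem_Ico, Finset.mem_Icc]; omega,
      show ⌈y⌉ = ⌊y⌋ + 1 by omega]
    ring

lemma sum_Ioc_Ioo (f : ℤ → ℤ) (a : ℤ) (y : ℚ) :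
    a < ⌈y⌉ → ∑ x ∈ Finset.Ioc a ⌊y⌋, f x - (⌊y⌋ - ⌈y⌉ + 1) * f ⌊y⌋ = 
      ∑ x ∈ Finset.Ioo a ⌈y⌉, f x := by
  intro h
  have h1 := Int.floor_le_ceil y
  have h2 := Int.ceil_le_floor_add_one y
  rcases eq_or_lt_of_le h1 with h3 | h3
  · rw [← h3] at h ⊢
    rw [show Finset.Ioc a ⌊y⌋ = insert ⌊y⌋ (Finset.Ioo a ⌊y⌋) by
      ext x; simp only [Finset.mem_Ioo, Finset.mem_Ioc, Finset.mem_insert]; omega,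
      Finset.sum_insert (by simp)]
    ring
  · rw [show Finset.Ioc a ⌊y⌋ = Finset.Ioo a ⌈y⌉ by
      ext x; simp only [Finset.mem_Ioo, Finset.mem_Ioc]; omega,
      show ⌈y⌉ = ⌊y⌋ + 1 by omega]
    ring

lemma fl_cl (y : ℚ) (n : ℤ) (hn : 0 < n) (F F' : ℚ → ℤ) (h : F y = F' y) :
    (⌊n * y⌋ - ⌈n * y⌉ + 1) * F y = (⌊n * y⌋ - ⌈n * y⌉ + 1) * F' (⌊n*y⌋ / n) := by
  have hn' : (0:ℚ) < n := by exact_mod_cast hn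
  have h1 := Int.floor_le_ceil (n*y)
  have h2 := Int.ceil_le_floor_add_one (n*y)
  rcases eq_or_lt_of_le h1 with h3 | h3
  · have h4 : (⌊n*y⌋:ℚ) = n * y := le_antisymm (Int.floor_le _) (by
      conv_rhs => rw [h3]
      exact Int.le_ceil _)
    rw [h4, mul_div_cancel_left₀ _ hn'.ne', h]
  · rw [show ⌈n*y⌉ = ⌊n*y⌋ + 1 by omega]
    ring

noncomputable def Ph (U G : ℚ → ℚ) (n x : ℤ) : ℤ := ⌊n * U (x / n)⌋ - ⌈n * G (x / n)⌉ + 1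
noncomputable def Ps (U G : ℚ → ℚ) (n x : ℤ) : ℤ := ⌈n * U (x / n)⌉ - ⌊n * G (x / n)⌋ - 1

lemma EE_pos (M X : ℤ) (N : ℕ) (U G : ℚ → ℚ) (hM : 0 < M) (hU : PLin M X N U)
    (hG : PLin M X N G) (n : ℤ) (hn : 0 < n) :
    EE M X N U G n = ∑ x ∈ Finset.Icc ⌈n * xp M X 0⌉ ⌊n * xp M X N⌋, Ph U G n x := by
  have hn' : (0:ℚ) < n := by exact_mod_cast hn
  have key : ∀ i ∈ Finset.range N,
    (gs (ph M (X+i) (U (xp M X i)) (U (xp M X (i+1))) (G (xp M X i)) (G (xp M X (i+1))) n)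
        ⌈n * xp M X (i+1)⌉
      - gs (ph M (X+i) (U (xp M X i)) (U (xp M X (i+1))) (G (xp M X i)) (G (xp M X (i+1))) n)
        ⌈n * xp M X i⌉) = gs (Ph U G n) ⌈n * xp M X (i+1)⌉ - gs (Ph U G n) ⌈n * xp M X i⌉ := by
    intro i hi
    have hi := Finset.mem_range.1 hi
    have hc : ⌈n * xp M X i⌉ ≤ ⌈n * xp M X (i+1)⌉ := by
      gcongr; exact xp_mono hM i
    rw [← gs_sub _ _ _ hc, ← gs_sub _ _ _ hc]
    refine Finset.sum_congr rfl fun x hx => ?_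
    rw [Finset.mem_Ico, Int.ceil_le, Int.lt_ceil] at hx
    unfold ph Ph
    rw [lpc_eq hU i hi n x hn hx.1 hx.2.le, lpc_eq hG i hi n x hn hx.1 hx.2.le]
  have hc : ⌈n * xp M X 0⌉ ≤ ⌈n * xp M X N⌉ := by
    gcongr; exact xp_mono' hM N
  unfold EE
  rw [Finset.sum_congr rfl key,
    Finset.sum_range_sub (fun i => gs (Ph U G n) ⌈n * xp M X i⌉) N, ← gs_sub _ _ _ hc,
    ← sum_Ico_Icc _ _ _ hc]
  congr 1
  exact fl_cl (xp M X N) n hn (fun y => ⌊n * U y⌋ - ⌈n * G y⌉ + 1)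
    (fun y => ⌊n * U y⌋ - ⌈n * G y⌉ + 1) rfl

lemma EE_neg (M X : ℤ) (N : ℕ) (U G : ℚ → ℚ) (hM : 0 < M) (hN : 0 < N) (hU : PLin M X N U)
    (hG : PLin M X N G) (n : ℤ) (hn : 0 < n) :
    EE M X N U G (-n) = ∑ x ∈ Finset.Ioo ⌊n * xp M X 0⌋ ⌈n * xp M X N⌉, Ps U G n x := by
  have hn' : (0:ℚ) < n := by exact_mod_cast hn
  have hM' : (0:ℚ) < M := by exact_mod_cast hM
  have refl : ∀ (f : ℤ → ℤ) (a b : ℤ), a ≤ b →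
      ∑ x ∈ Finset.Ioc a b, f x = gs f (b+1) - gs f (a+1) := by
    intro f a b h
    rw [← gs_sub _ _ _ (by omega)]
    congr 1; ext x; simp only [Finset.mem_Ioc, Finset.mem_Ico]; omega
  have key : ∀ i ∈ Finset.range N,
    (gs (ph M (X+i) (U (xp M X i)) (U (xp M X (i+1))) (G (xp M X i)) (G (xp M X (i+1))) (-n))
        ⌈((-n : ℤ):ℚ) * xp M X (i+1)⌉
      - gs (ph M (X+i) (U (xp M X i)) (U (xp M X (i+1))) (G (xp M X i)) (G (xp M X (i+1))) (-n))
        ⌈((-n:ℤ):ℚ) * xp M X i⌉) =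
        gs (Ps U G n) (⌊n * xp M X (i+1)⌋ + 1) - gs (Ps U G n) (⌊n * xp M X i⌋ + 1) := by
    intro i hi
    have hi := Finset.mem_range.1 hi
    have hc : ⌊n * xp M X i⌋ ≤ ⌊n * xp M X (i+1)⌋ := by
      gcongr; exact xp_mono hM i
    rw [← refl _ _ _ hc]
    push_cast
    rw [neg_mul, neg_mul, Int.ceil_neg, Int.ceil_neg, ← neg_sub, ← gs_sub _ _ _ (by omega),
      ← Finset.sum_neg_distrib]
    refine Finset.sum_bij (fun x _ => -x) ?_ ?_ ?_ ?_
    · intro x hx; simp only [Finset.mem_Ico, Finset.mem_Ioc] at *; omega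
    · intro x _ y _ h; simpa using h
    · intro x hx; refine ⟨-x, ?_, by simp⟩
      simp only [Finset.mem_Ico, Finset.mem_Ioc] at *; omega
    · intro x hx
      obtain ⟨y, rfl⟩ : ∃ y, x = -y := ⟨-x, by simp⟩
      have hy : ⌊n * xp M X i⌋ < y ∧ y ≤ ⌊n * xp M X (i+1)⌋ := by
        simp only [Finset.mem_Ico] at hx; omega
      rw [Int.floor_lt, Int.le_floor] at hy
      unfold ph Ps
      rw [lpc_neg, lpc_neg, neg_neg, lpc_eq hU i hi n y hn hy.1.le hy.2,
        lpc_eq hG i hi n y hn hy.1.le hy.2, Int.floor_neg, Int.ceil_neg]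
      ring
  have hlt : xp M X 0 < xp M X N := by
    unfold xp; gcongr
  have hc : ⌊n * xp M X 0⌋ ≤ ⌊n * xp M X N⌋ := by
    gcongr
  have hc' : ⌊n * xp M X 0⌋ < ⌈n * xp M X N⌉ := by
    rw [Int.lt_ceil]
    refine (Int.floor_le _).trans_lt ?_
    gcongr
  unfold EE
  rw [Finset.sum_congr rfl key,
    Finset.sum_range_sub (fun i => gs (Ps U G n) (⌊n * xp M X i⌋ + 1)) N, ← refl _ _ _ hc,
    ← sum_Ioc_Ioo _ _ _ hc', sub_eq_add_neg]
  congr 1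
  unfold en
  push_cast
  simp only [neg_mul, Int.floor_neg, Int.ceil_neg]
  have := fl_cl (xp M X N) n hn (fun y => ⌈n * U y⌉ - ⌊n * G y⌋ - 1)
    (fun y => ⌈n * U y⌉ - ⌊n * G y⌋ - 1) rfl
  unfold Ps
  rw [← this]
  ring

lemma EE_main (M X : ℤ) (N : ℕ) (U G : ℚ → ℚ) (T : ℤ) (hM : 0 < M) (hN : 0 < N) (hT : 0 < T)
    (hU : PLin M X N U) (hG : PLin M X N G)
    (hUT : ∀ i ≤ N, ∃ a : ℤ, T * U (xp M X i) = a)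
    (hGT : ∀ i ≤ N, ∃ a : ℤ, T * G (xp M X i) = a)
    (hGU : ∀ x, xp M X 0 ≤ x → x ≤ xp M X N → G x ≤ U x)
    (p : Polynomial ℚ)
    (hp : ∀ n : ℕ, 0 < n → ((∑ x ∈ Finset.Icc ⌈(n:ℤ) * xp M X 0⌉ ⌊(n:ℤ) * xp M X N⌋,
      Ph U G n x : ℤ) : ℚ) = p.eval (n : ℚ))
    (hb : ∀ x : ℤ, xp M X 0 ≤ x → x ≤ xp M X N → ∀ y : ℤ, G x ≤ y → y ≤ U x →
      G x < y ∧ y < U x ∧ xp M X 0 < x ∧ x < xp M X N) : False := by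
  have hTM : 0 < T * M := by positivity
  have hTM' : (0:ℚ) < (T * M : ℤ) := by exact_mod_cast hTM
  have hQ := QP_EE M X N U G T hM hUT hGT
  have hE : ∀ n : ℤ, 0 < n → (EE M X N U G n : ℚ) = p.eval (n:ℚ) := by
    intro n hn
    lift n to ℕ using hn.le
    have := hp n (by exact_mod_cast hn)
    rw [EE_pos M X N U G hM hU hG n hn, this]; simp
  have hE' : ∀ r : ℤ, ∃ a b c : ℚ, (∀ k : ℤ, (EE M X N U G (r + T*M*k) : ℚ) = a + b*k+c*k^2) ∧
      ∀ t : ℚ, p.eval (r + (T * M : ℤ)*t) = a + b * t + c * t^2 := by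
    intro r
    obtain ⟨a, b, c, h⟩ := hQ r
    refine ⟨a, b, c, h, ?_⟩
    have : p.comp (Polynomial.C (r:ℚ) + Polynomial.C ((T*M:ℤ):ℚ) * Polynomial.X) =
        Polynomial.C a + Polynomial.C b * Polynomial.X + Polynomial.C c * Polynomial.X^2 := by
      refine Polynomial.eq_of_infinite_eval_eq _ _ ?_
      refine Set.infinite_of_injective_forall_mem (f := fun k : ℕ => ((k + |r| + 1 : ℤ) : ℚ)) ?_ ?_
      · intro k l h; simpa using h
      · intro k
        have hpos : 0 < r + T * M * (k + |r| + 1) := by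
          have := neg_abs_le r
          have : 1 * (k + |r| + 1) ≤ T * M * (k + |r| + 1) := by
            gcongr; omega
          omega
        have h1 := hE _ hpos
        have h0 := h (k + |r| + 1)
        simp only at h0
        rw [h0] at h1
        simp only [Set.mem_ofPred_eq, Polynomial.eval_comp, Polynomial.eval_add,
          Polynomial.eval_mul, Polynomial.eval_C, Polynomial.eval_X, Polynomial.eval_pow]
        rw [h1]; push_cast; rfl
    intro t
    have := congrArg (Polynomial.eval t) this
    simpa [Polynomial.eval_comp] using this
  have hall : ∀ n : ℤ, (EE M X N U G n : ℚ) = p.eval (n:ℚ) := by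
    intro n
    obtain ⟨a, b, c, h1, h2⟩ := hE' n
    have h1 := h1 0
    have h2 := h2 0
    simp at h1 h2
    rw [h1, h2]
  have hone : EE M X N U G 1 = EE M X N U G (-1) := by
    rw [EE_pos M X N U G hM hU hG 1 one_pos, EE_neg M X N U G hM hN hU hG 1 one_pos]
    symm
    simp only [Int.cast_one, one_mul]
    have hsub : Finset.Ioo ⌊xp M X 0⌋ ⌈xp M X N⌉ ⊆ Finset.Icc ⌈xp M X 0⌉ ⌊xp M X N⌋ := by
      intro x hx
      simp only [Finset.mem_Ioo, Finset.mem_Icc] at *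
      have := Int.ceil_le_floor_add_one (xp M X 0)
      have := Int.ceil_le_floor_add_one (xp M X N)
      omega
    rw [← Finset.sum_subset hsub (f := Ph U G 1)]
    · refine Finset.sum_congr rfl fun x hx => ?_
      have hx := hsub hx
      rw [Finset.mem_Icc, Int.ceil_le, Int.le_floor] at hx
      have hb := hb x hx.1 hx.2
      have hGU := hGU x hx.1 hx.2
      unfold Ph Ps
      simp only [Int.cast_one, one_mul, div_one]
      have e1 : ⌈U x⌉ = ⌊U x⌋ + 1 := by
        refine le_antisymm (Int.ceil_le_floor_add_one _) ?_
        by_contra hh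
        have : ⌈U x⌉ = ⌊U x⌋ := by have := Int.floor_le_ceil (U x); omega
        have hy : (⌊U x⌋:ℚ) = U x := le_antisymm (Int.floor_le _) (by
          rw [← this]; exact Int.le_ceil _)
        have := hb ⌊U x⌋ (by rw [hy]; exact hGU) hy.le
        rw [hy] at this
        exact lt_irrefl _ this.2.1
      have e2 : ⌈G x⌉ = ⌊G x⌋ + 1 := by
        refine le_antisymm (Int.ceil_le_floor_add_one _) ?_
        by_contra hh
        have : ⌈G x⌉ = ⌊G x⌋ := by have := Int.floor_le_ceil (G x); omega
        have hy : (⌊G x⌋:ℚ) = G x := le_antisymm (Int.floor_le _) (by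
          rw [← this]; exact Int.le_ceil _)
        have := hb ⌊G x⌋ hy.ge (by rw [hy]; exact hGU)
        rw [hy] at this
        exact lt_irrefl _ this.1
      omega
    · intro x hx hx'
      rw [Finset.mem_Icc, Int.ceil_le, Int.le_floor] at hx
      rw [Finset.mem_Ioo, Int.floor_lt, Int.lt_ceil] at hx'
      have hb := hb x hx.1 hx.2
      have hGU := hGU x hx.1 hx.2
      unfold Ph
      simp only [Int.cast_one, one_mul, div_one]
      have h1 : ¬ ⌈G x⌉ ≤ ⌊U x⌋ := by
        intro h
        have := hb ⌊U x⌋ (by rw [← Int.ceil_le]; exact h) (Int.floor_le _)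
        exact hx' this.2.2
      have h2 : ⌊G x⌋ ≤ ⌊U x⌋ := by gcongr
      have := Int.ceil_le_floor_add_one (G x)
      omega
  have hD : EE M X N U G (-(T*M)) < EE M X N U G (T*M) := by
    rw [EE_pos M X N U G hM hU hG _ hTM, EE_neg M X N U G hM hN hU hG _ hTM]
    generalize hDD : T * M = D at *
    have hsub : Finset.Ioo ⌊D * xp M X 0⌋ ⌈D * xp M X N⌉ ⊆
        Finset.Icc ⌈D * xp M X 0⌉ ⌊D * xp M X N⌋ := by
      intro x hx
      simp only [Finset.mem_Ioo, Finset.mem_Icc] at *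
      have := Int.ceil_le_floor_add_one (D * xp M X 0)
      have := Int.ceil_le_floor_add_one (D * xp M X N)
      omega
    have hM' : (M:ℚ) ≠ 0 := by positivity
    have hx0 : D * xp M X 0 = (T * X : ℤ) := by
      rw [← hDD]; unfold xp; push_cast; field_simp; ring
    have hle : ∀ x ∈ Finset.Icc ⌈D * xp M X 0⌉ ⌊D * xp M X N⌋, 
        D * G (x / D) ≤ D * U (x / D) := by
      intro x hx
      rw [Finset.mem_Icc, Int.ceil_le, Int.le_floor] at hx
      have := hGU (x / D) (by rw [le_div_iff₀ hTM']; linarith) (by rw [div_le_iff₀ hTM']; linarith)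
      gcongr
    calc _ ≤ ∑ x ∈ Finset.Ioo ⌊D * xp M X 0⌋ ⌈D * xp M X N⌉, Ph U G D x := by
          refine Finset.sum_le_sum fun x hx => ?_
          unfold Ph Ps
          have := Int.ceil_le_floor_add_one (D * G (x / D))
          have := Int.ceil_le_floor_add_one (D * U (x / D))
          omega
      _ < _ := by
        refine Finset.sum_lt_sum_of_subset hsub (i := T * X) ?_ ?_ ?_ ?_
        · rw [Finset.mem_Icc, Int.ceil_le, Int.le_floor, hx0]
          refine ⟨le_rfl, ?_⟩
          rw [← hx0]
          have := xp_mono' (X := X) hM N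
          gcongr
        · rw [hx0, Int.floor_intCast]; simp
        · have h1 : ((T*X : ℤ):ℚ) / D = xp M X 0 := by
            rw [← hx0, mul_div_cancel_left₀ _ hTM'.ne']
          unfold Ph
          rw [h1]
          obtain ⟨a, ha⟩ := hUT 0 (by omega)
          obtain ⟨b, hb⟩ := hGT 0 (by omega)
          have e1 : D * U (xp M X 0) = (M * a : ℤ) := by
            rw [← hDD]; push_cast; rw [← ha]; ring
          have e2 : D * G (xp M X 0) = (M * b : ℤ) := by
            rw [← hDD]; push_cast; rw [← hb]; ring
          have e3 : (D:ℚ) * G (xp M X 0) ≤ D * U (xp M X 0) := by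
            have := hGU _ le_rfl (xp_mono' (X := X) hM N)
            gcongr
          rw [e1, e2] at *
          simp only [Int.floor_intCast, Int.ceil_intCast]
          have : M * b ≤ M * a := by exact_mod_cast e3
          omega
        · intro x hx _
          have : ⌊D * G (x/D)⌋ ≤ ⌊D * U (x/D)⌋ := by
            have := hle x hx
            gcongr
          unfold Ph
          have := Int.ceil_le_floor_add_one (D * G (x / D))
          omega
  obtain ⟨a, b, c, -, h2⟩ := hE' 0
  have f1 := hall 1
  have f2 := hall (-1)
  have f3 := hall (T*M)
  have f4 := hall (-(T*M))
  have g1 := h2 (1/(T*M:ℤ))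
  have g2 := h2 (-1/(T*M:ℤ))
  have g3 := h2 1
  have g4 := h2 (-1)
  have hne := hTM'.ne'
  rw [hone, f2] at f1
  rw [Int.cast_zero, zero_add, mul_div_cancel₀ _ hne] at g1 g2
  rw [show ((0:ℤ):ℚ) + (T*M:ℤ) * 1 = (T*M:ℤ) by simp] at g3
  rw [show ((0:ℤ):ℚ) + (T*M:ℤ) * (-1) = ((-(T*M):ℤ):ℚ) by push_cast; ring] at g4
  rw [show (((-1:ℤ)):ℚ) = -1 by simp, Int.cast_one, g1, g2] at f1
  have hb0 : b = 0 := by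
    have h5 : b * (1 / ((T*M:ℤ):ℚ)) = 0 := by
      have : (-1 / ((T*M:ℤ):ℚ)) = - (1 / ((T*M:ℤ):ℚ)) := by ring
      rw [this] at f1
      nlinarith
    rcases mul_eq_zero.1 h5 with h | h
    · exact h
    · exact absurd h (one_div_ne_zero hne)
  have : (EE M X N U G (-(T*M)) : ℚ) < EE M X N U G (T*M) := by exact_mod_cast hD
  rw [f3, f4, g3, g4, hb0] at this
  linarith

def Sp (V : Finset (ℚ × ℚ)) (c H : ℚ) : Prop :=
  (∃ l ∈ V, ∃ r ∈ V, ∃ t : ℚ, 0 ≤ t ∧ t ≤ 1 ∧ l.1 ≤ c ∧ c ≤ r.1 ∧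
    c = (1-t) * l.1 + t * r.1 ∧ H = (1-t) * l.2 + t * r.2) ∧
  ∃ m : ℚ, ∀ v ∈ V, v.2 ≤ H + m * (v.1 - c)

lemma exists_Sp (V : Finset (ℚ × ℚ)) (c : ℚ) (hl : ∃ l ∈ V, l.1 ≤ c) (hr : ∃ r ∈ V, c ≤ r.1) :
    ∃ H, Sp V c H := by
  obtain ⟨l0, hl0, hl0c⟩ := hl
  obtain ⟨r0, hr0, hr0c⟩ := hr
  let W := (V ×ˢ V).filter (fun q => q.1.1 ≤ c ∧ c ≤ q.2.1)
  let tt : (ℚ × ℚ) × (ℚ × ℚ) → ℚ := fun q => (c - q.1.1) / (q.2.1 - q.1.1)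
  let val : (ℚ × ℚ) × (ℚ × ℚ) → ℚ := fun q => (1 - tt q) * q.1.2 + tt q * q.2.2
  obtain ⟨⟨l, r⟩, hq, hmax⟩ := Finset.exists_max_image W val
    ⟨(l0, r0), by simp [W, *]⟩
  have hq' : (l ∈ V ∧ r ∈ V) ∧ l.1 ≤ c ∧ c ≤ r.1 := by simpa [W] using hq
  obtain ⟨⟨hlV, hrV⟩, hlc, hrc⟩ := hq'
  have hpair : ∀ l ∈ V, ∀ r ∈ V, l.1 < c → c < r.1 →
      l.2 * (r.1 - c) + r.2 * (c - l.1) ≤ val (l, r) * (r.1 - l.1) := by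
    intro l hl r hr h1 h2
    have : r.1 - l.1 ≠ 0 := by linarith
    apply le_of_eq
    simp only [val, tt]
    field_simp
    ring
  generalize hH : val (l, r) = H at *
  refine ⟨H, ⟨l, hlV, r, hrV, tt (l, r), ?_, ?_, hlc, hrc, ?_, hH.symm⟩, ?_⟩
  · simp only [tt]; apply div_nonneg <;> linarith
  · simp only [tt]; apply div_le_one_of_le₀ <;> linarith
  · simp only [tt]
    by_cases h : r.1 - l.1 = 0
    · rw [h]; simp; linarith
    · field_simp; ring
  have heq : ∀ v ∈ V, v.1 = c → v.2 ≤ H := by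
    intro v hv h
    have := hmax (v, v) (by simp [W, hv, h])
    simpa [val, tt] using this
  have hpair : ∀ l ∈ V, ∀ r ∈ V, l.1 < c → c < r.1 →
      l.2 * (r.1 - c) + r.2 * (c - l.1) ≤ H * (r.1 - l.1) := by
    intro l hl r hr h1 h2
    refine (hpair l hl r hr h1 h2).trans ?_
    have := hmax (l, r) (by simp [W, hl, hr, h1.le, h2.le])
    have h3 : 0 ≤ r.1 - l.1 := by linarith
    gcongr
  by_cases hA : (V.filter (fun v => c < v.1)).Nonempty
  · obtain ⟨r, hr, hrm⟩ := Finset.exists_max_image _ (fun v => (v.2 - H) / (v.1 - c)) hA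
    rw [Finset.mem_filter] at hr
    refine ⟨(r.2 - H) / (r.1 - c), fun v hv => ?_⟩
    have hrc : 0 < r.1 - c := by linarith [hr.2]
    rcases lt_trichotomy v.1 c with h | h | h
    · have := hpair v hv r hr.1 h hr.2
      rw [← sub_le_iff_le_add', div_mul_eq_mul_div, le_div_iff₀ hrc]
      linarith
    · have := heq v hv h
      rw [h]; simpa using this
    · have := hrm v (by simp [hv, h])
      have h0 : 0 < v.1 - c := by linarith
      rw [div_le_iff₀ h0] at this
      linarith
  · rw [Finset.not_nonempty_iff_eq_empty, Finset.filter_eq_empty_iff] at hA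
    by_cases hB : (V.filter (fun v => v.1 < c)).Nonempty
    · obtain ⟨r, hr, hrm⟩ := Finset.exists_min_image _ (fun v => (H - v.2) / (c - v.1)) hB
      rw [Finset.mem_filter] at hr
      refine ⟨(H - r.2) / (c - r.1), fun v hv => ?_⟩
      rcases lt_trichotomy v.1 c with h | h | h
      · have := hrm v (by simp [hv, h])
        have h0 : 0 < c - v.1 := by linarith
        rw [le_div_iff₀ h0] at this
        linarith
      · have := heq v hv h
        rw [h]; simpa using this
      · exact absurd h (hA hv)
    · rw [Finset.not_nonempty_iff_eq_empty, Finset.filter_eq_empty_iff] at hB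
      refine ⟨0, fun v hv => ?_⟩
      have := heq v hv (le_antisymm (not_lt.1 (hA hv)) (not_lt.1 (hB hv)))
      linarith

lemma Sp_bound {V : Finset (ℚ × ℚ)} {c H : ℚ} (h : Sp V c H) {l r : ℚ × ℚ} (hl : l ∈ V)
    (hr : r ∈ V) (t : ℚ) (h0 : 0 ≤ t) (h1 : t ≤ 1) (hc : c = (1-t) * l.1 + t * r.1) :
    (1-t) * l.2 + t * r.2 ≤ H := by
  obtain ⟨m, hm⟩ := h.2
  have e1 := mul_le_mul_of_nonneg_left (hm l hl) (sub_nonneg.2 h1)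
  have e2 := mul_le_mul_of_nonneg_left (hm r hr) h0
  have : (1-t) * (H + m * (l.1 - c)) + t * (H + m * (r.1 - c)) = H := by
    rw [hc]; ring
  linarith

lemma Sp_PLin (V : Finset (ℚ × ℚ)) (M X : ℤ) (N : ℕ) (hM : 0 < M) (U : ℚ → ℚ)
    (hV : ∀ v ∈ V, ∃ a : ℤ, M * v.1 = a)
    (hU : ∀ x, xp M X 0 ≤ x → x ≤ xp M X N → Sp V x (U x)) : PLin M X N U := by
  intro i hi x hax hxb
  have hM' : (0:ℚ) < M := by exact_mod_cast hM
  have hMa : M * xp M X i = (X + i : ℤ) := by unfold xp; field_simp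
  have hMb : M * xp M X (i+1) = (X + i : ℤ) + 1 := by unfold xp; push_cast; field_simp; ring
  have h0a : xp M X 0 ≤ xp M X i := xp_mono' hM i
  have hbN : xp M X (i+1) ≤ xp M X N := by
    unfold xp; gcongr; omega
  have hSa := hU _ h0a (by linarith)
  have hSb := hU _ (by linarith) hbN
  have hSx := hU x (by linarith) (by linarith)
  rw [← hMa]
  rw [← hMa] at hMb
  generalize xp M X i = a at *
  generalize xp M X (i+1) = b at *
  obtain ⟨s, hs⟩ : ∃ s, s = M * x - M * a := ⟨_, rfl⟩
  rw [← hs]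
  have hs0 : 0 ≤ s := by rw [hs, ← mul_sub]; apply mul_nonneg hM'.le; linarith
  have hs1 : s ≤ 1 := by
    have : 0 ≤ M * (b - x) := by apply mul_nonneg hM'.le; linarith
    rw [hs]; linarith
  have hxs : x = (1-s)*a + s * b := by
    apply mul_left_cancel₀ hM'.ne'
    have : M * ((1-s)*a + s * b) = (1-s) * (M * a) + s * (M * b) := by ring
    rw [this, hMb]; linarith
  apply le_antisymm
  · rcases eq_or_lt_of_le hax with rfl | hax
    · have : s = 0 := by linarith
      rw [this]; simp
    rcases eq_or_lt_of_le hxb with rfl | hxb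
    · have : s = 1 := by linarith
      rw [this]; simp
    obtain ⟨l, hl, r, hr, t, ht0, ht1, hlx, hxr, hx, hH⟩ := hSx.1
    have hla : l.1 ≤ a := by
      obtain ⟨z, hz⟩ := hV l hl
      by_contra hc
      push Not at hc
      have q1 : M * a < M * l.1 := by gcongr
      have q2 : M * l.1 < M * b := by gcongr; linarith
      rw [hMb] at q2
      rw [hz, hMa] at q1 q2
      have q1 : X + i < z := by exact_mod_cast q1
      have q2 : z < X + i + 1 := by exact_mod_cast q2
      omega
    have hbr : b ≤ r.1 := by
      obtain ⟨z, hz⟩ := hV r hr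
      by_contra hc
      push Not at hc
      have q1 : M * r.1 < M * b := by gcongr
      have q2 : M * a < M * r.1 := by gcongr; linarith
      rw [hMb] at q1
      rw [hz, hMa] at q1 q2
      have q2 : X + i < z := by exact_mod_cast q2
      have q1 : z < X + i + 1 := by exact_mod_cast q1
      omega
    have hd : 0 < r.1 - l.1 := by linarith
    have ba := Sp_bound hSa hl hr ((a - l.1)/(r.1-l.1)) (div_nonneg (by linarith) hd.le)
      (div_le_one_of_le₀ (by linarith) hd.le) (by field_simp; ring)
    have bb := Sp_bound hSb hl hr ((b - l.1)/(r.1-l.1)) (div_nonneg (by linarith) hd.le)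
      (div_le_one_of_le₀ (by linarith) hd.le) (by field_simp; ring)
    have htt : t = (1-s) * ((a - l.1)/(r.1-l.1)) + s * ((b - l.1)/(r.1-l.1)) := by
      have : t * (r.1 - l.1) = x - l.1 := by linarith
      rw [eq_comm] at this
      rw [eq_div_of_mul_eq hd.ne' this.symm, hxs]; ring
    have e1 := mul_le_mul_of_nonneg_left ba (sub_nonneg.2 hs1)
    have e2 := mul_le_mul_of_nonneg_left bb hs0
    rw [hH, htt]
    linarith
  · obtain ⟨m, hm⟩ := hSx.2
    have key : ∀ c, Sp V c (U c) → U c ≤ U x + m * (c - x) := by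
      intro c hc
      obtain ⟨l, hl, r, hr, t, ht0, ht1, hlx, hxr, hx, hH⟩ := hc.1
      have e1 := mul_le_mul_of_nonneg_left (hm l hl) (sub_nonneg.2 ht1)
      have e2 := mul_le_mul_of_nonneg_left (hm r hr) ht0
      rw [hH, hx]
      linarith
    have e1 := mul_le_mul_of_nonneg_left (key a hSa) (sub_nonneg.2 hs1)
    have e2 := mul_le_mul_of_nonneg_left (key b hSb) hs0
    have : (1-s) * (U x + m * (a - x)) + s * (U x + m * (b-x)) = U x := by
      have : (1-s) * (U x + m * (a - x)) + s * (U x + m * (b-x)) =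
        U x + m * ((1-s)*a + s*b - x) := by ring
      rw [this, ← hxs]; ring
    linarith

lemma common_den (s : Finset ℚ) : ∃ T : ℤ, 0 < T ∧ ∀ q ∈ s, ∃ a : ℤ, T * q = a := by
  classical
  induction s using Finset.induction_on with
  | empty => exact ⟨1, one_pos, by simp⟩
  | insert q s _ ih =>
    obtain ⟨T, hT, h⟩ := ih
    refine ⟨T * q.den, by have := q.den_pos; positivity, ?_⟩
    intro q' hq'
    rcases Finset.mem_insert.1 hq' with rfl | hq'
    · refine ⟨T * q'.num, ?_⟩
      push_cast
      rw [mul_assoc, Rat.den_mul_eq_num]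
    · obtain ⟨a, ha⟩ := h q' hq'
      exact ⟨a * q.den, by push_cast; rw [← ha]; ring⟩

def emb (q : ℚ × ℚ) : ℝ × ℝ := ((q.1 : ℝ), (q.2 : ℝ))

lemma hull_le (V : Finset (ℚ × ℚ)) (a b c : ℝ) (h : ∀ v ∈ V, a * v.1 + b * v.2 ≤ c)
    (q : ℝ × ℝ) (hq : q ∈ convexHull ℝ (emb '' V)) : a * q.1 + b * q.2 ≤ c := by
  have : convexHull ℝ (emb '' V) ⊆ {q : ℝ × ℝ | a * q.1 + b * q.2 ≤ c} := by
    refine convexHull_min ?_ ?_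
    · rintro _ ⟨v, hv, rfl⟩
      exact h v hv
    · refine convex_halfSpace_le (f := fun q : ℝ × ℝ => a * q.1 + b * q.2) ?_ c
      exact ⟨fun x y => by simp; ring, fun r x => by simp; ring⟩
  exact this hq

lemma hull_comb (V : Finset (ℚ × ℚ)) (l r : ℚ × ℚ) (t : ℚ) (h0 : 0 ≤ t) (h1 : t ≤ 1)
    (hl : emb l ∈ convexHull ℝ (emb '' V)) (hr : emb r ∈ convexHull ℝ (emb '' V)) :
    emb ((1-t) * l.1 + t * r.1, (1-t) * l.2 + t * r.2) ∈ convexHull ℝ (emb '' V) := by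
  have h1' : (t:ℝ) ≤ 1 := by exact_mod_cast h1
  have := (convex_convexHull ℝ (emb '' V)) hl hr (a := 1 - (t:ℝ)) (b := t) (by linarith)
    (by exact_mod_cast h0) (by ring)
  convert this using 1
  simp [emb]

lemma Sp_mem {V : Finset (ℚ × ℚ)} {c H : ℚ} (h : Sp V c H) :
    emb (c, H) ∈ convexHull ℝ (emb '' V) := by
  obtain ⟨l, hl, r, hr, t, ht0, ht1, hlx, hxr, hx, hH⟩ := h.1
  rw [hx, hH]
  exact hull_comb V l r t ht0 ht1 (subset_convexHull ℝ _ ⟨l, hl, rfl⟩)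
    (subset_convexHull ℝ _ ⟨r, hr, rfl⟩)

lemma Sp_le {V : Finset (ℚ × ℚ)} {c H : ℚ} (h : Sp V c H) (y : ℝ)
    (hy : ((c:ℝ), y) ∈ convexHull ℝ (emb '' V)) : y ≤ H := by
  obtain ⟨m, hm⟩ := h.2
  have := hull_le V (-m) 1 (H - m * c) (fun v hv => by
    have h1 : (v.2:ℝ) ≤ H + m * (v.1 - c) := by exact_mod_cast hm v hv
    linarith) _ hy
  simp at this
  linarith

lemma not_interior (S : Set (ℝ × ℝ)) (q d : ℝ × ℝ) (h : ∀ e : ℝ, 0 < e → q + e • d ∉ S) :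
    q ∉ interior S := by
  intro hq
  have hc : Filter.Tendsto (fun e : ℝ => q + e • d) (nhdsWithin 0 (Set.Ioi 0)) (nhds q) := by
    have : Continuous (fun e : ℝ => q + e • d) := by fun_prop
    have := this.tendsto 0
    simp only [zero_smul, add_zero] at this
    exact this.mono_left nhdsWithin_le_nhds
  have h1 : ∀ᶠ e : ℝ in nhdsWithin 0 (Set.Ioi 0), q + e • d ∈ S := hc (mem_interior_iff_mem_nhds.1 hq)
  have h2 : ∀ᶠ e : ℝ in nhdsWithin 0 (Set.Ioi 0), 0 < e := eventually_mem_nhdsWithin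
  obtain ⟨e, he, he'⟩ := (h1.and h2).exists
  exact h e he' he

def rfl2 (V : Finset (ℚ × ℚ)) : Finset (ℚ × ℚ) := V.image (fun v => (v.1, -v.2))

lemma Sp_refl_mem {V : Finset (ℚ × ℚ)} {c H : ℚ} (h : Sp (rfl2 V) c H) :
    emb (c, -H) ∈ convexHull ℝ (emb '' V) := by
  obtain ⟨l, hl, r, hr, t, ht0, ht1, hlx, hxr, hx, hH⟩ := h.1
  obtain ⟨l, hlV, rfl⟩ := Finset.mem_image.1 hl
  obtain ⟨r, hrV, rfl⟩ := Finset.mem_image.1 hr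
  have := hull_comb V l r t ht0 ht1 (subset_convexHull ℝ _ ⟨l, hlV, rfl⟩)
    (subset_convexHull ℝ _ ⟨r, hrV, rfl⟩)
  convert this using 3
  rw [hH]; simp; ring

lemma Sp_refl_le {V : Finset (ℚ × ℚ)} {c H : ℚ} (h : Sp (rfl2 V) c H) (y : ℝ)
    (hy : ((c:ℝ), y) ∈ convexHull ℝ (emb '' V)) : ((-H : ℚ) : ℝ) ≤ y := by
  obtain ⟨m, hm⟩ := h.2
  have := hull_le V (-m) (-1) (H - m * c) (fun v hv => by
    have h1 := hm (v.1, -v.2) (Finset.mem_image_of_mem _ hv)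
    simp only at h1
    have h1 : -(v.2:ℝ) ≤ H + m * (v.1 - c) := by exact_mod_cast h1
    linarith) _ hy
  simp at this
  push_cast
  linarith

theorem main_aux (V : Finset (ℚ × ℚ)) (hcol : ¬ Collinear ℝ (emb '' (V : Set (ℚ × ℚ))))
    (p : Polynomial ℚ)
    (hp : ∀ n : ℕ, 0 < n → (ehr (convexHull ℝ (emb '' V)) n : ℚ) = p.eval (n : ℚ))
    (hf : ∀ z : ℤ × ℤ, ((z.1 : ℝ), (z.2 : ℝ)) ∉ frontier (convexHull ℝ (emb '' V))) : False := by
  classical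
  have hne : V.Nonempty := by
    rw [Finset.nonempty_iff_ne_empty]
    rintro rfl
    exact hcol (by simpa using collinear_empty ℝ (ℝ × ℝ))
  obtain ⟨v1, hv1, hmin⟩ := Finset.exists_min_image V Prod.fst hne
  obtain ⟨v2, hv2, hmax⟩ := Finset.exists_max_image V Prod.fst hne
  have hlt : v1.1 < v2.1 := by
    by_contra hc
    push Not at hc
    apply hcol
    rw [collinear_iff_of_mem (p₀ := emb v1) (Set.mem_image_of_mem _ hv1)]
    refine ⟨(0, 1), ?_⟩
    rintro _ ⟨v, hv, rfl⟩
    have e : v.1 = v1.1 := le_antisymm ((hmax v hv).trans hc) (hmin v hv)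
    refine ⟨v.2 - v1.2, ?_⟩
    simp [emb, e]
  obtain ⟨M, hM, hMV⟩ := common_den (V.image Prod.fst)
  have hMV : ∀ v ∈ V, ∃ a : ℤ, M * v.1 = a := fun v hv =>
    hMV _ (Finset.mem_image_of_mem _ hv)
  have hM' : (0:ℚ) < M := by exact_mod_cast hM
  obtain ⟨X, hX⟩ := hMV v1 hv1
  obtain ⟨Y, hY⟩ := hMV v2 hv2
  have hXY : X < Y := by
    have : (X:ℚ) < Y := by rw [← hX, ← hY]; gcongr
    exact_mod_cast this
  obtain ⟨N, hN⟩ := Int.eq_ofNat_of_zero_le (sub_nonneg.2 hXY.le)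
  have hx0 : xp M X 0 = v1.1 := by
    unfold xp; rw [div_eq_iff hM'.ne']; push_cast; rw [← hX]; ring
  have hxN : xp M X N = v2.1 := by
    unfold xp; rw [div_eq_iff hM'.ne', ← hN]; push_cast; rw [← hY]; ring
  have exU : ∀ c, ∃ H, xp M X 0 ≤ c → c ≤ xp M X N → Sp V c H := by
    intro c
    by_cases h : xp M X 0 ≤ c ∧ c ≤ xp M X N
    · obtain ⟨H, hH⟩ := exists_Sp V c ⟨v1, hv1, by rw [← hx0]; exact h.1⟩
        ⟨v2, hv2, by rw [← hxN]; exact h.2⟩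
      exact ⟨H, fun _ _ => hH⟩
    · exact ⟨0, fun h1 h2 => absurd ⟨h1, h2⟩ h⟩
  have exG : ∀ c, ∃ H, xp M X 0 ≤ c → c ≤ xp M X N → Sp (rfl2 V) c H := by
    intro c
    by_cases h : xp M X 0 ≤ c ∧ c ≤ xp M X N
    · obtain ⟨H, hH⟩ := exists_Sp (rfl2 V) c
        ⟨_, Finset.mem_image_of_mem _ hv1, by rw [← hx0]; exact h.1⟩
        ⟨_, Finset.mem_image_of_mem _ hv2, by rw [← hxN]; exact h.2⟩
      exact ⟨H, fun _ _ => hH⟩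
    · exact ⟨0, fun h1 h2 => absurd ⟨h1, h2⟩ h⟩
  choose U hU using exU
  choose G' hG' using exG
  let G : ℚ → ℚ := fun x => - G' x
  have hUP : PLin M X N U := Sp_PLin V M X N hM U hMV hU
  have hGP : PLin M X N G := by
    have := Sp_PLin (rfl2 V) M X N hM G' (by
      intro v hv
      obtain ⟨w, hw, rfl⟩ := Finset.mem_image.1 hv
      exact hMV w hw) hG'
    intro i hi x h1 h2
    have := this i hi x h1 h2
    simp only [G]
    rw [this]; ring
  obtain ⟨T, hT, hTq⟩ := common_den
    ((Finset.range (N+1)).image (fun i => U (xp M X i)) ∪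
      (Finset.range (N+1)).image (fun i => G (xp M X i)))
  -- membership
  have hmemx : ∀ q ∈ convexHull ℝ (emb '' (V : Set (ℚ × ℚ))),
      ((xp M X 0 : ℚ) : ℝ) ≤ q.1 ∧ q.1 ≤ ((xp M X N : ℚ) : ℝ) := by
    intro q hq
    constructor
    · have := hull_le V (-1) 0 (-(xp M X 0 : ℚ)) (fun v hv => by
        have : ((xp M X 0 : ℚ) : ℝ) ≤ v.1 := by rw [hx0]; exact_mod_cast hmin v hv
        linarith) q hq
      linarith
    · have := hull_le V 1 0 ((xp M X N : ℚ)) (fun v hv => by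
        have : (v.1 : ℝ) ≤ (xp M X N : ℚ) := by rw [hxN]; exact_mod_cast hmax v hv
        linarith) q hq
      linarith
  have hmem : ∀ x y : ℚ, emb (x, y) ∈ convexHull ℝ (emb '' (V : Set (ℚ × ℚ))) ↔
      (xp M X 0 ≤ x ∧ x ≤ xp M X N) ∧ G x ≤ y ∧ y ≤ U x := by
    intro x y
    constructor
    · intro h
      have h1 := hmemx _ h
      simp only [emb, Rat.cast_le] at h1
      refine ⟨h1, ?_, ?_⟩
      · have := Sp_refl_le (hG' x h1.1 h1.2) y h
        exact_mod_cast this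
      · have := Sp_le (hU x h1.1 h1.2) y h
        exact_mod_cast this
    · rintro ⟨⟨h1, h2⟩, h3, h4⟩
      have m1 := Sp_refl_mem (hG' x h1 h2)
      have m2 := Sp_mem (hU x h1 h2)
      rcases eq_or_lt_of_le (h3.trans h4) with h5 | h5
      · have : y = U x := by linarith
        rw [this]; exact m2
      · have hd : 0 < U x - G x := by linarith
        have := hull_comb V (x, G x) (x, U x) ((y - G x) / (U x - G x))
          (div_nonneg (by linarith) hd.le) (div_le_one_of_le₀ (by linarith) hd.le) m1 m2
        convert this using 3
        · simp only; ring
        · simp only; field_simp; ring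
  have hGU : ∀ x, xp M X 0 ≤ x → x ≤ xp M X N → G x ≤ U x := by
    intro x h1 h2
    exact ((hmem x (U x)).1 (Sp_mem (hU x h1 h2))).2.1
  refine EE_main M X N U G T hM (by omega) hT hUP hGP
    (fun i hi => hTq _ (Finset.mem_union_left _ (Finset.mem_image.2 ⟨i, by simp; omega, rfl⟩)))
    (fun i hi => hTq _ (Finset.mem_union_right _ (Finset.mem_image.2 ⟨i, by simp; omega, rfl⟩)))
    hGU p ?_ ?_
  · intro n hn
    rw [← hp n hn]
    have hn' : (0:ℚ) < (n:ℤ) := by exact_mod_cast hn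
    have hset : {z : ℤ × ℤ | ((z.1 : ℝ), (z.2 : ℝ)) ∈ (n : ℝ) • convexHull ℝ (emb '' (V : Set (ℚ × ℚ)))}
        = (((Finset.Icc ⌈(n:ℤ) * xp M X 0⌉ ⌊(n:ℤ) * xp M X N⌋).biUnion (fun x =>
          (Finset.Icc ⌈(n:ℤ) * G (x / (n:ℤ))⌉ ⌊(n:ℤ) * U (x / (n:ℤ))⌋).image (Prod.mk x)) :
            Finset (ℤ × ℤ)) : Set (ℤ × ℤ)) := by
      ext ⟨a, b⟩
      have hn0 : (n:ℝ) ≠ 0 := by positivity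
      have e : (n:ℝ)⁻¹ • ((a:ℝ), (b:ℝ)) = emb (a / (n:ℤ), b / (n:ℤ)) := by
        simp [emb]; constructor <;> ring
      have key := hmem (a / (n:ℤ)) (b / (n:ℤ))
      rw [le_div_iff₀ hn', div_le_iff₀ hn', le_div_iff₀ hn', div_le_iff₀ hn'] at key
      have : ((a:ℝ), (b:ℝ)) ∈ (n : ℝ) • convexHull ℝ (emb '' (V : Set (ℚ × ℚ))) ↔ 
        (⌈(n:ℤ) * xp M X 0⌉ ≤ a ∧ a ≤ ⌊(n:ℤ) * xp M X N⌋) ∧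
        (⌈(n:ℤ) * G (a / (n:ℤ))⌉ ≤ b ∧ b ≤ ⌊(n:ℤ) * U (a / (n:ℤ))⌋) := by
        rw [Set.mem_smul_set_iff_inv_smul_mem₀ hn0, e, key, Int.ceil_le, Int.ceil_le,
          Int.le_floor, Int.le_floor]
        simp only [mul_comm]
      simp only [Set.mem_ofPred_eq, Finset.mem_coe, Finset.mem_biUnion, Finset.mem_image,
        Finset.mem_Icc, Prod.mk.injEq]
      rw [this]
      constructor
      · rintro ⟨h1, h2⟩
        exact ⟨a, h1, b, h2, rfl, rfl⟩
      · rintro ⟨_, h1, _, h2, rfl, rfl⟩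
        exact ⟨h1, h2⟩
    unfold ehr
    rw [hset, Set.ncard_coe_finset, Finset.card_biUnion]
    · push_cast
      refine Finset.sum_congr rfl fun x hx => ?_
      rw [Finset.card_image_of_injective _ (Prod.mk_right_injective x), Int.card_Icc]
      rw [Finset.mem_Icc, Int.ceil_le, Int.le_floor] at hx
      have h1 := hGU (x / (n:ℤ)) (by rw [le_div_iff₀ hn']; push_cast; linarith)
        (by rw [div_le_iff₀ hn']; push_cast; linarith)
      have h2 : ⌊(n:ℤ) * G (x / (n:ℤ))⌋ ≤ ⌊(n:ℤ) * U (x / (n:ℤ))⌋ := by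
        gcongr
      have h3 := Int.ceil_le_floor_add_one ((n:ℤ) * G (x / (n:ℤ)))
      have h4 : Ph U G n x = ((⌊(n:ℤ) * U (x / (n:ℤ))⌋ + 1 - ⌈(n:ℤ) * G (x / (n:ℤ))⌉).toNat : ℤ) := by
        rw [Int.toNat_of_nonneg (by omega)]
        unfold Ph; ring
      rw [h4]; norm_cast
    · intro x _ y _ hxy
      rw [Function.onFun, Finset.disjoint_left]
      intro z hz hz'
      obtain ⟨_, _, rfl⟩ := Finset.mem_image.1 hz
      obtain ⟨_, _, h⟩ := Finset.mem_image.1 hz'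
      exact hxy (Prod.mk.inj h).1.symm
  · intro x h1 h2 y h3 h4
    have hin := (hmem x y).2 ⟨⟨h1, h2⟩, h3, h4⟩
    have hint : emb (x, y) ∈ interior (convexHull ℝ (emb '' (V : Set (ℚ × ℚ)))) := by
      by_contra hc
      refine hf (x, y) ?_
      have : emb (x, y) ∈ frontier (convexHull ℝ (emb '' (V : Set (ℚ × ℚ)))) :=
        ⟨subset_closure hin, hc⟩
      simpa [emb] using this
    refine ⟨lt_of_le_of_ne h3 ?_, lt_of_le_of_ne h4 ?_, lt_of_le_of_ne h1 ?_,
      lt_of_le_of_ne h2 ?_⟩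
    · intro he
      refine not_interior _ _ (0, -1) (fun e he' hm => ?_) hint
      have := Sp_refl_le (hG' x h1 h2) (y - e) (by
        convert hm using 1; simp [emb]; ring)
      have h5 : ((-G' x : ℚ):ℝ) = ((y:ℚ):ℝ) := by rw [← he]
      rw [h5] at this
      push_cast at this
      linarith
    · intro he
      refine not_interior _ _ (0, 1) (fun e he' hm => ?_) hint
      have := Sp_le (hU x h1 h2) (y + e) (by
        convert hm using 1; simp [emb])
      rw [← he] at this
      push_cast at this
      linarith
    · intro he
      refine not_interior _ _ (-1, 0) (fun e he' hm => ?_) hint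
      have := (hmemx _ hm).1
      rw [he] at this
      simp [emb] at this
      linarith
    · intro he
      refine not_interior _ _ (1, 0) (fun e he' hm => ?_) hint
      have := (hmemx _ hm).2
      rw [← he] at this
      simp [emb] at this
      linarith

/-- There is no rational polygon (convex hull of finitely many rational points, not all
collinear) whose Ehrhart quasi-polynomial is a polynomial and which has no lattice
points on its boundary. -/
theorem stmt_8 :
    ¬ ∃ V : Finset (ℚ × ℚ),
      ¬ Collinear ℝ ((fun q : ℚ × ℚ => ((q.1 : ℝ), (q.2 : ℝ))) '' ↑V) ∧
      (∃ p : Polynomial ℚ, ∀ n : ℕ, 0 < n →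
        (ehr (convexHull ℝ ((fun q : ℚ × ℚ => ((q.1 : ℝ), (q.2 : ℝ))) '' ↑V)) n : ℚ)
          = p.eval (n : ℚ)) ∧
      {z : ℤ × ℤ | ((z.1 : ℝ), (z.2 : ℝ)) ∈
        frontier (convexHull ℝ ((fun q : ℚ × ℚ => ((q.1 : ℝ), (q.2 : ℝ))) '' ↑V))} = ∅ := by
  rintro ⟨V, hcol, ⟨p, hp⟩, hf⟩
  refine main_aux V hcol p hp fun z hz => ?_
  have : z ∈ (∅ : Set (ℤ × ℤ)) := by
    rw [← hf]; exact hz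
  exact this
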